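/- arXiv:math/0104020 — 2 statements merged into one kernel-verified Lean document; each statement's English description precedes it below -/
import Mathlib

section
/- Let H be a real-valued function, twice continuously differentiable on the open cone Sym⁺(n) of symmetric positive definite n×n real matrices, such that: (i) for every X ∈ Sym⁺(n) there exists Υ(X) ∈ Sym⁺(n) such that the Hessian of H at X acts on symmetric matrices as H''(X)A = Υ(X)⁻¹ A Υ(X)⁻¹; (ii) for all X, S ∈ Sym⁺(n) there exists W ∈ Sym⁺(n) with H''(W)X = S and H''(X) = H''(W) ∘ H''(S) ∘ H''(W); and (iii) there exists ν > 0 such that ⟨H'(X), (H''(X))⁻¹ H'(X)⟩ ≤ ν for all X ∈ Sym⁺(n), where H'(X) ∈ Sym(n,ℝ) is the gradient of H at X with respect to the trace inner product. Then there exist constants c₁ > 0 and c₀ ∈ ℝ such that H(X) = c₀ − c₁ ln det(X) for all X ∈ Sym⁺(n). -/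
open Matrix

attribute [local instance]
  Matrix.frobeniusNormedAddCommGroup Matrix.frobeniusNormedSpace

open scoped MatrixOrder in
theorem Matrix.PosDef.eq_of_mul_self_eq {m : Type*} [Fintype m] [DecidableEq m]
    {A B : Matrix m m ℝ} (hA : A.PosDef) (hB : B.PosDef) (h : A * A = B * B) : A = B := by
  rw [← CFC.sqrt_mul_self A hA.posSemidef.nonneg, h, CFC.sqrt_mul_self B hB.posSemidef.nonneg]

open scoped MatrixOrder in
theorem Matrix.PosDef.exists_posDef_mul_self_eq {m : Type*} [Fintype m] [DecidableEq m]
    {X : Matrix m m ℝ} (hX : X.PosDef) : ∃ G : Matrix m m ℝ, G.PosDef ∧ G * G = X := by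
  have h := CFC.sqrt_mul_sqrt_self X hX.posSemidef.nonneg
  refine ⟨CFC.sqrt X, ?_, h⟩
  rw [(CFC.sqrt_nonneg X).posSemidef.posDef_iff_det_ne_zero]
  intro h0
  have := hX.det_pos
  rw [← h, det_mul, h0] at this
  simp at this

theorem Matrix.PosDef.isSymm_real {m : Type*} [Fintype m]
    {A : Matrix m m ℝ} (hA : A.PosDef) : A.IsSymm := by
  have h := hA.isHermitian.eq
  rwa [conjTranspose_eq_transpose_of_trivial] at h

theorem Matrix.PosDef.mul_mul_self {m : Type*} [Fintype m] [DecidableEq m]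
    {G X : Matrix m m ℝ} (hG : G.PosDef) (hX : X.PosDef) : (G * X * G).PosDef := by
  have h := hX.mul_mul_conjTranspose_same (B := G)
    (vecMul_injective_of_isUnit hG.isUnit)
  rwa [hG.isHermitian.eq] at h

theorem Matrix.PosDef.mul_inv_cancel' {m : Type*} [Fintype m] [DecidableEq m]
    {G : Matrix m m ℝ} (hG : G.PosDef) : G * G⁻¹ = 1 :=
  mul_nonsing_inv _ hG.det_pos.ne'.isUnit

theorem Matrix.PosDef.inv_mul_cancel' {m : Type*} [Fintype m] [DecidableEq m]
    {G : Matrix m m ℝ} (hG : G.PosDef) : G⁻¹ * G = 1 :=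
  nonsing_inv_mul _ hG.det_pos.ne'.isUnit

/-- The Riccati equation `G X G = S` has at most one positive definite solution. -/
theorem Matrix.PosDef.eq_of_mul_mul_self_eq {m : Type*} [Fintype m] [DecidableEq m]
    {G Q X : Matrix m m ℝ} (hG : G.PosDef) (hQ : Q.PosDef) (hX : X.PosDef)
    (h : G * X * G = Q * X * Q) : G = Q := by
  obtain ⟨R, hR, rfl⟩ := hX.exists_posDef_mul_self_eq
  have key : R * G * R = R * Q * R := by
    refine (hR.mul_mul_self hG).eq_of_mul_self_eq (hR.mul_mul_self hQ) ?_
    calc R * G * R * (R * G * R) = R * (G * (R * R) * G) * R := by simp only [Matrix.mul_assoc]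
      _ = R * Q * R * (R * Q * R) := by rw [h]; simp only [Matrix.mul_assoc]
  exact hR.isUnit.mul_left_cancel (hR.isUnit.mul_right_cancel key)

/-- A map `P` on positive definite matrices satisfying the scaling-point identity is
equivariant under congruence by positive definite matrices. -/
theorem map_mul_mul_self_of_scaling {m : Type*} [Fintype m] [DecidableEq m]
    {P : Matrix m m ℝ → Matrix m m ℝ} (hP : ∀ X, X.PosDef → (P X).PosDef)
    (h2 : ∀ X S, X.PosDef → S.PosDef → ∃ W : Matrix m m ℝ, W.PosDef ∧
      P W * X * P W = S ∧ P X * P X = P W * (P S * (P W * P W) * P S) * P W)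
    {G X : Matrix m m ℝ} (hG : G.PosDef) (hX : X.PosDef) :
    G * P (G * X * G) * G = P X := by
  obtain ⟨W, hW, hWX, hWP⟩ := h2 X _ hX (hG.mul_mul_self hX)
  obtain rfl := (hP W hW).eq_of_mul_mul_self_eq hG hX hWX
  refine (hG.mul_mul_self (hP _ (hG.mul_mul_self hX))).eq_of_mul_self_eq (hP X hX) ?_
  rw [hWP]
  simp only [Matrix.mul_assoc]

theorem map_inv_mul_mul_inv_of_scaling {m : Type*} [Fintype m] [DecidableEq m]
    {P : Matrix m m ℝ → Matrix m m ℝ}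
    (hP : ∀ G X : Matrix m m ℝ, G.PosDef → X.PosDef → G * P (G * X * G) * G = P X)
    {G X : Matrix m m ℝ} (hG : G.PosDef) (hX : X.PosDef) :
    P (G⁻¹ * X * G⁻¹) = G * P X * G := by
  rw [← hP G⁻¹ X hG.inv hX]
  calc _ = (G * G⁻¹) * P (G⁻¹ * X * G⁻¹) * (G⁻¹ * G) := by
        rw [hG.mul_inv_cancel', hG.inv_mul_cancel']; simp
    _ = _ := by simp only [Matrix.mul_assoc]

/-- The value at `1` of a congruence-equivariant map is fixed by all orthogonal matrices
which are products of three positive definite ones. -/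
theorem mul_map_one_mul_of_scaling {m : Type*} [Fintype m] [DecidableEq m]
    {P : Matrix m m ℝ → Matrix m m ℝ}
    (hP : ∀ G X : Matrix m m ℝ, G.PosDef → X.PosDef → G * P (G * X * G) * G = P X)
    {A D B : Matrix m m ℝ} (hA : A.PosDef) (hD : D.PosDef) (hB : B.PosDef)
    (h : A * (D * D) * A = B * B) : A * (D * P 1 * D) * A = B * P 1 * B := by
  rw [← map_inv_mul_mul_inv_of_scaling hP hD .one,
    ← map_inv_mul_mul_inv_of_scaling hP hA (hD.inv.mul_mul_self .one),
    ← map_inv_mul_mul_inv_of_scaling hP hB .one]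
  congr 1
  have := congrArg (·⁻¹) h
  simpa [Matrix.mul_inv_rev, Matrix.mul_assoc] using this

/-- Extend an endomorphism `M` of a coordinate subspace by the identity on its complement;
the subspace is given by a partial isometry `E`. -/
def Matrix.extendOne {m k : Type*} [Fintype k] [DecidableEq m] [DecidableEq k]
    (E : Matrix m k ℝ) (M : Matrix k k ℝ) : Matrix m m ℝ := 1 + E * (M - 1) * Eᵀ

section extendOne

variable {m k : Type*} [Fintype k] [DecidableEq m] [DecidableEq k] {E : Matrix m k ℝ}

theorem Matrix.extendOne_one : extendOne E (1 : Matrix k k ℝ) = 1 := by simp [extendOne]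

theorem Matrix.extendOne_transpose (M : Matrix k k ℝ) :
    (extendOne E M)ᵀ = extendOne E Mᵀ := by
  simp [extendOne, Matrix.mul_assoc]

variable [Fintype m]

theorem Matrix.extendOne_mul (hE : Eᵀ * E = 1) (M N : Matrix k k ℝ) :
    extendOne E (M * N) = extendOne E M * extendOne E N := by
  have h : E * (M - 1) * Eᵀ * (E * (N - 1) * Eᵀ) = E * ((M - 1) * (N - 1)) * Eᵀ := by
    calc _ = E * (M - 1) * (Eᵀ * E) * (N - 1) * Eᵀ := by simp only [Matrix.mul_assoc]
      _ = _ := by rw [hE]; simp only [Matrix.mul_assoc, Matrix.one_mul]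
  have h' : M * N - 1 = (M - 1) * (N - 1) + (M - 1) + (N - 1) := by noncomm_ring
  simp only [extendOne, Matrix.add_mul, Matrix.mul_add, Matrix.one_mul, Matrix.mul_one, h]
  rw [h']
  simp only [Matrix.add_mul, Matrix.mul_add]
  abel

theorem Matrix.PosDef.extendOne (hE : Eᵀ * E = 1) {M : Matrix k k ℝ} (hM : M.PosDef) :
    (extendOne E M).PosDef := by
  obtain ⟨G, hG, rfl⟩ := hM.exists_posDef_mul_self_eq
  have hu : IsUnit (Matrix.extendOne E G) := by
    refine IsUnit.of_mul_eq_one (Matrix.extendOne E G⁻¹) ?_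
    rw [← extendOne_mul hE, hG.mul_inv_cancel', extendOne_one]
  have h := PosDef.conjTranspose_mul_self (Matrix.extendOne E G)
    (mulVec_injective_of_isUnit hu)
  rwa [conjTranspose_eq_transpose_of_trivial, extendOne_transpose, hG.isSymm_real,
    ← extendOne_mul hE] at h

end extendOne

theorem Matrix.posDef_fin_two {a b c : ℝ} (ha : 0 < a) (h : 0 < a * c - b * b) :
    (!![a, b; b, c] : Matrix (Fin 2) (Fin 2) ℝ).PosDef := by
  refine PosDef.of_dotProduct_mulVec_pos ?_ fun {x} hx => ?_
  · ext i j; fin_cases i <;> fin_cases j <;> simp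
  · simp only [dotProduct, mulVec, Fin.sum_univ_two]
    simp
    have : x 0 ≠ 0 ∨ x 1 ≠ 0 := by
      by_contra! h0
      exact hx (by ext i; fin_cases i <;> simp [h0])
    refine pos_of_mul_pos_right (a := a) ?_ ha.le
    have e : a * (x 0 * (a * x 0 + b * x 1) + x 1 * (b * x 0 + c * x 1)) =
      (a * x 0 + b * x 1) ^ 2 + (a * c - b * b) * x 1 ^ 2 := by ring
    rw [e]
    by_cases h1 : x 1 = 0
    · have := this.resolve_right (by simpa using h1)
      simp [h1]; positivity
    · positivity

/-- The value at `1` of a congruence-equivariant map is a scalar matrix. -/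
theorem map_one_eq_smul_of_scaling {m : Type*} [Fintype m] [DecidableEq m]
    {P : Matrix m m ℝ → Matrix m m ℝ} (hP1 : (P 1).PosDef)
    (hP : ∀ G X : Matrix m m ℝ, G.PosDef → X.PosDef → G * P (G * X * G) * G = P X) :
    ∃ κ : ℝ, 0 < κ ∧ P 1 = κ • 1 := by
  have key : ∀ i j, i ≠ j → P 1 i j = 0 ∧ P 1 i i = P 1 j j := by
    intro i j hij
    set E : Matrix m (Fin 2) ℝ := of fun k b => if k = ![i, j] b then 1 else 0 with hEdef
    have hE : Eᵀ * E = 1 := by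
      ext a b
      fin_cases a <;> fin_cases b <;> simp [hEdef, Matrix.mul_apply, hij.symm]
      rw [Finset.sum_eq_single i] <;> simp +contextual
    set A : Matrix (Fin 2) (Fin 2) ℝ := !![25, -40; -40, 400]
    set D : Matrix (Fin 2) (Fin 2) ℝ := !![16, 0; 0, 1]
    set B : Matrix (Fin 2) (Fin 2) ℝ := !![296, -272; -272, 704]
    set O : Matrix (Fin 2) (Fin 2) ℝ := !![4/5, -3/5; 3/5, 4/5]
    have hA : A.PosDef := posDef_fin_two (by norm_num) (by norm_num)
    have hD : D.PosDef := posDef_fin_two (by norm_num) (by norm_num)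
    have hB : B.PosDef := posDef_fin_two (by norm_num) (by norm_num)
    have hO : O * Oᵀ = 1 := by
      ext a b; fin_cases a <;> fin_cases b <;> simp [O, Matrix.mul_apply] <;> norm_num
    have hO' : Oᵀ * O = 1 := mul_eq_one_comm.mp hO
    have hADO : A * D * O = B := by
      ext a b
      fin_cases a <;> fin_cases b <;> simp [A, D, B, O, Matrix.mul_apply] <;> norm_num
    have hODA : Oᵀ * D * A = B := by
      have := congrArg transpose hADO
      rwa [transpose_mul, transpose_mul, hA.isSymm_real, hB.isSymm_real, hD.isSymm_real,
        ← Matrix.mul_assoc] at this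
    have hBB : A * (D * D) * A = B * B := by
      nth_rw 1 [← hADO]
      rw [← hODA]
      calc A * (D * D) * A = A * D * (O * Oᵀ) * D * A := by
            rw [hO]; simp only [Matrix.mul_assoc, Matrix.one_mul]
        _ = _ := by simp only [Matrix.mul_assoc]
    have h := mul_map_one_mul_of_scaling hP (hA.extendOne hE) (hD.extendOne hE)
      (hB.extendOne hE) (by simp only [← extendOne_mul hE, hBB])
    nth_rw 1 [← hADO] at h
    rw [← hODA] at h
    simp only [extendOne_mul hE] at h
    have h' : extendOne E O * P 1 * extendOne E Oᵀ = P 1 := by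
      have uA := (hA.extendOne hE).isUnit
      have uD := (hD.extendOne hE).isUnit
      simp only [← Matrix.mul_assoc] at h
      have h := uD.mul_right_cancel (uA.mul_right_cancel h)
      simp only [Matrix.mul_assoc] at h
      have h := uD.mul_left_cancel (uA.mul_left_cancel h)
      simpa only [Matrix.mul_assoc] using h.symm
    have hc : extendOne E O * P 1 = P 1 * extendOne E O := by
      nth_rw 2 [← h']
      rw [Matrix.mul_assoc _ (extendOne E Oᵀ), ← extendOne_mul hE, hO', extendOne_one,
        Matrix.mul_one]
    have hc2 : O * (Eᵀ * P 1 * E) = (Eᵀ * P 1 * E) * O := by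
      have e1 : Eᵀ * extendOne E O = O * Eᵀ := by
        simp only [extendOne, Matrix.mul_add, ← Matrix.mul_assoc, hE]
        simp [Matrix.sub_mul]
      have e2 : extendOne E O * E = E * O := by
        simp only [extendOne, Matrix.add_mul, Matrix.mul_assoc, hE]
        simp [Matrix.mul_sub]
      calc _ = (O * Eᵀ) * P 1 * E := by simp only [Matrix.mul_assoc]
        _ = Eᵀ * (extendOne E O * P 1) * E := by rw [← e1]; simp only [Matrix.mul_assoc]
        _ = _ := by rw [hc]; simp only [Matrix.mul_assoc, e2]
    have hsub : Eᵀ * P 1 * E = (P 1).submatrix ![i, j] ![i, j] := by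
      ext a b
      simp [Matrix.mul_apply, hEdef]
    rw [hsub] at hc2
    have hs : P 1 j i = P 1 i j := hP1.isSymm_real.apply i j
    have h00 := congrFun₂ hc2 0 0
    have h01 := congrFun₂ hc2 0 1
    rw [Matrix.mul_apply, Matrix.mul_apply, Fin.sum_univ_two, Fin.sum_univ_two] at h00 h01
    simp [O, hs] at h00 h01
    constructor <;> linarith
  rcases isEmpty_or_nonempty m with hm | ⟨⟨i⟩⟩
  · exact ⟨1, one_pos, Subsingleton.elim _ _⟩
  · refine ⟨P 1 i i, hP1.diag_pos, ?_⟩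
    ext a b
    by_cases hab : a = b
    · subst hab
      by_cases hia : i = a
      · subst hia; simp
      · simp [(key i a hia).2]
    · simp [hab, (key a b hab).1]

theorem eq_smul_inv_of_scaling {m : Type*} [Fintype m] [DecidableEq m]
    {P : Matrix m m ℝ → Matrix m m ℝ} (hP1 : (P 1).PosDef)
    (hP : ∀ G X : Matrix m m ℝ, G.PosDef → X.PosDef → G * P (G * X * G) * G = P X) :
    ∃ κ : ℝ, 0 < κ ∧ ∀ X, X.PosDef → P X = κ • X⁻¹ := by
  obtain ⟨κ, hκ, h⟩ := map_one_eq_smul_of_scaling hP1 hP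
  refine ⟨κ, hκ, fun X hX => ?_⟩
  obtain ⟨G, hG, rfl⟩ := hX.exists_posDef_mul_self_eq
  have := map_inv_mul_mul_inv_of_scaling hP hG.inv .one
  have hi : G⁻¹⁻¹ = G := nonsing_inv_nonsing_inv _ hG.det_pos.ne'.isUnit
  simpa [hi, h, Matrix.mul_inv_rev] using this

theorem Matrix.PosDef.hasDerivAt_inv_add_smul {m : Type*} [Fintype m] [DecidableEq m]
    {X : Matrix m m ℝ} (hX : X.PosDef) (A : Matrix m m ℝ) :
    HasDerivAt (fun t : ℝ => (X + t • A)⁻¹) (-(X⁻¹ * A * X⁻¹)) 0 := by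
  let _ : NormedRing (Matrix m m ℝ) := Matrix.frobeniusNormedRing
  let _ : NormedAlgebra ℝ (Matrix m m ℝ) := Matrix.frobeniusNormedAlgebra
  have hline : HasDerivAt (fun t : ℝ => X + t • A) A 0 := by
    have h := ((hasDerivAt_id (0 : ℝ)).smul_const A).const_add X
    rwa [one_smul] at h
  have h := hasFDerivAt_ringInverse (𝕜 := ℝ) hX.isUnit.unit
  have := h.comp_hasDerivAt_of_eq (0 : ℝ) hline (by simp)
  simp [Function.comp_def, ← nonsing_inv_eq_ringInverse] at this
  exact this

theorem Matrix.PosDef.hasDerivAt_log_det_add_smul {m : Type*} [Fintype m] [DecidableEq m]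
    {X : Matrix m m ℝ} (hX : X.PosDef) (A : Matrix m m ℝ) :
    HasDerivAt (fun t : ℝ => Real.log (X + t • A).det) ((X⁻¹ * A).trace) 0 := by
  have e : ∀ t : ℝ, (X + t • A).det = X.det * (1 + t • (X⁻¹ * A)).det := fun t => by
    rw [← det_mul, Matrix.mul_add, Matrix.mul_one, Matrix.mul_smul, ← Matrix.mul_assoc,
      hX.mul_inv_cancel', Matrix.one_mul]
  set q := (det (1 + (Polynomial.X : Polynomial ℝ) • (X⁻¹ * A).map Polynomial.C)).divX.divX
  have hd : HasDerivAt (fun t : ℝ => 1 + (X⁻¹ * A).trace * t + q.eval t * t ^ 2)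
      ((X⁻¹ * A).trace) 0 := by
    have h1 := ((hasDerivAt_id (0 : ℝ)).const_mul (X⁻¹ * A).trace).const_add 1
    have h2 := (q.hasDerivAt 0).mul (hasDerivAt_pow 2 (0 : ℝ))
    convert! h1.add h2 using 1
    simp
  have hd' := (hd.const_mul X.det).log (by simpa using hX.det_pos.ne')
  simp_rw [e]
  have e' : ∀ t : ℝ, (1 + t • (X⁻¹ * A)).det = _ := fun t => det_one_add_smul t _
  simp_rw [e']
  convert! hd' using 1
  have := hX.det_pos.ne'
  simp
  field_simp

/-- A function on positive definite matrices whose directional derivatives vanish is constant. -/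
theorem eq_of_hasDerivAt_zero_of_posDef {m F : Type*} [Fintype m] [DecidableEq m]
    [NormedAddCommGroup F] [NormedSpace ℝ F] {f : Matrix m m ℝ → F}
    (hf : ∀ X, X.PosDef → ∀ A, A.IsSymm → HasDerivAt (fun t : ℝ => f (X + t • A)) 0 0)
    {X : Matrix m m ℝ} (hX : X.PosDef) : f X = f 1 := by
  set g : ℝ → F := fun t => f (1 + t • (X - 1))
  have hg : ∀ t ∈ Set.Icc (0 : ℝ) 1, HasDerivAt g 0 t := by
    intro t ht
    have hpd : (1 + t • (X - 1)).PosDef := by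
      have e : 1 + t • (X - 1) = (1 - t) • (1 : Matrix m m ℝ) + t • X := by module
      rw [e]
      rcases ht.1.eq_or_lt with rfl | h0
      · simpa using PosDef.one
      · exact PosDef.posSemidef_add (PosSemidef.one.smul (sub_nonneg.2 ht.2)) (hX.smul h0)
    have h := hf _ hpd (X - 1) (hX.isSymm_real.sub isSymm_one)
    have h' := HasDerivAt.comp_sub_const (x := t) (a := t) (by rw [sub_self]; exact h)
    refine h'.congr_of_eventuallyEq (.of_forall fun s => ?_)
    simp only [g]
    congr 1
    module
  have := constant_of_has_deriv_right_zero (a := (0 : ℝ)) (b := 1) (f := g)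
    (fun t ht => (hg t ht).continuousAt.continuousWithinAt)
    (fun t ht => (hg t ⟨ht.1, ht.2.le⟩).hasDerivWithinAt) 1 ⟨zero_le_one, le_rfl⟩
  simpa [g] using this

/-- If `tr ((t C - a)²)` is bounded over `t > 0` for a symmetric matrix `C`, then `C = 0`. -/
theorem Matrix.IsSymm.eq_zero_of_trace_sq_le {m : Type*} [Fintype m] [DecidableEq m]
    {C : Matrix m m ℝ} (hC : C.IsSymm) {a b : ℝ}
    (h : ∀ t : ℝ, 0 < t → ((t • C - a • 1) * (t • C - a • 1)).trace ≤ b) : C = 0 := by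
  have hsq : 0 ≤ (C * C).trace := by
    have := (posSemidef_conjTranspose_mul_self C).trace_nonneg
    rwa [conjTranspose_eq_transpose_of_trivial, hC] at this
  have hexp : ∀ t : ℝ, ((t • C - a • 1) * (t • C - a • 1)).trace =
      t ^ 2 * (C * C).trace - 2 * a * t * C.trace + a ^ 2 * (1 : Matrix m m ℝ).trace := by
    intro t
    simp only [Matrix.sub_mul, Matrix.mul_sub, trace_sub, Matrix.smul_mul, Matrix.mul_smul,
      trace_smul, smul_eq_mul, Matrix.mul_one, Matrix.one_mul]
    ring
  have h0 : (C * C).trace = 0 := by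
    by_contra hne
    have hpos : 0 < (C * C).trace := lt_of_le_of_ne hsq (Ne.symm hne)
    set p := (C * C).trace
    set q := 2 * a * C.trace
    set r := a ^ 2 * (1 : Matrix m m ℝ).trace
    have key := h (1 + (|q| + |b| + |r|) / p) (by positivity)
    rw [hexp] at key
    set s := (|q| + |b| + |r|) / p with hs
    have hs0 : 0 ≤ s := by positivity
    have hsp : s * p = |q| + |b| + |r| := by rw [hs]; field_simp
    have h1 := neg_abs_le r
    have h2 := le_abs_self b
    have h3 := le_abs_self q
    have h4 : 0 ≤ |b| := abs_nonneg b
    have h5 : 0 ≤ |r| := abs_nonneg r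
    have e : (1 + s) ^ 2 * p - 2 * a * (1 + s) * C.trace =
      (1 + s) * (p + s * p - q) := by simp only [q]; ring
    rw [e] at key
    rw [hsp] at key
    nlinarith [mul_nonneg hs0 (sub_nonneg.2 h3), mul_nonneg hs0 h4, mul_nonneg hs0 h5,
      mul_nonneg hs0 hpos.le]
  have := trace_conjTranspose_mul_self_eq_zero_iff (A := C)
  rw [conjTranspose_eq_transpose_of_trivial, hC] at this
  exact this.1 h0

/-- Let `H` be twice continuously differentiable on the cone `Sym⁺(n)` of symmetric
positive definite matrices, with gradient `grad X` and Hessian `Hess X` at `X`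
(w.r.t. the trace inner product), such that (i) every Hessian is of the form
`A ↦ Υ(X)⁻¹ A Υ(X)⁻¹` with `Υ(X) ∈ Sym⁺(n)`, (ii) for all `X, S ∈ Sym⁺(n)` there is a
scaling point `W ∈ Sym⁺(n)` with `H''(W) X = S` and `H''(X) = H''(W) ∘ H''(S) ∘ H''(W)`,
and (iii) for some `ν > 0` the Newton decrement bound
`⟨H'(X), (H''(X))⁻¹ H'(X)⟩ ≤ ν` holds for all `X ∈ Sym⁺(n)`.  Then there exist
constants `c₁ > 0` and `c₀ ∈ ℝ` such that `H(X) = c₀ - c₁ ln det X` on `Sym⁺(n)`. -/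
theorem statement9 (n : ℕ) (H : Matrix (Fin n) (Fin n) ℝ → ℝ)
    (grad : Matrix (Fin n) (Fin n) ℝ → Matrix (Fin n) (Fin n) ℝ)
    (Hess : Matrix (Fin n) (Fin n) ℝ →
      Matrix (Fin n) (Fin n) ℝ →ₗ[ℝ] Matrix (Fin n) (Fin n) ℝ)
    -- `grad X` is the gradient of `H` at `X` w.r.t. the trace inner product:
    -- the directional derivative of `H` at `X` in a symmetric direction `A` is
    -- `⟨grad X, A⟩ = tr (grad X * A)`, and `grad X` is symmetric.
    (hgrad : ∀ X, X.PosDef → ∀ A, A.IsSymm →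
      HasDerivAt (fun t : ℝ => H (X + t • A)) ((grad X * A).trace) 0)
    (hgradsymm : ∀ X, X.PosDef → (grad X).IsSymm)
    -- `Hess X` is the Hessian of `H` at `X`: the derivative of the gradient at `X`
    -- in a symmetric direction `A` is `Hess X A`, and the gradient map is continuous.
    (hHess : ∀ X, X.PosDef → ∀ A, A.IsSymm →
      HasDerivAt (fun t : ℝ => grad (X + t • A)) (Hess X A) 0)
    (hC2 : ∀ X, X.PosDef → ContinuousAt grad X)
    -- (i): each Hessian is a congruence `A ↦ Υ(X)⁻¹ A Υ(X)⁻¹` by some `Υ(X) ∈ Sym⁺(n)`.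
    (h1 : ∀ X, X.PosDef → ∃ U : Matrix (Fin n) (Fin n) ℝ, U.PosDef ∧
      ∀ A, A.IsSymm → Hess X A = U⁻¹ * A * U⁻¹)
    -- (ii): the Nesterov–Todd scaling point identity.
    (h2 : ∀ X S, X.PosDef → S.PosDef → ∃ W : Matrix (Fin n) (Fin n) ℝ, W.PosDef ∧
      Hess W X = S ∧ ∀ A, A.IsSymm → Hess X A = Hess W (Hess S (Hess W A)))
    -- (iii): the Newton decrement bound: whenever `B` is the symmetric solution of
    -- `Hess X B = grad X`, we have `⟨grad X, B⟩ ≤ ν`.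
    (h3 : ∃ ν : ℝ, 0 < ν ∧ ∀ X, X.PosDef → ∀ B, B.IsSymm →
      Hess X B = grad X → (grad X * B).trace ≤ ν) :
    ∃ c₁ : ℝ, 0 < c₁ ∧ ∃ c₀ : ℝ, ∀ X : Matrix (Fin n) (Fin n) ℝ, X.PosDef →
      H X = c₀ - c₁ * Real.log X.det := by
  choose! U hUpd hU using h1
  obtain ⟨ν, -, hν⟩ := h3
  have hP : ∀ X, X.PosDef → (U X)⁻¹.PosDef := fun X hX => (hUpd X hX).inv
  have hNT : ∀ X S, X.PosDef → S.PosDef → ∃ W : Matrix (Fin n) (Fin n) ℝ, W.PosDef ∧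
      (U W)⁻¹ * X * (U W)⁻¹ = S ∧ (U X)⁻¹ * (U X)⁻¹ =
        (U W)⁻¹ * ((U S)⁻¹ * ((U W)⁻¹ * (U W)⁻¹) * (U S)⁻¹) * (U W)⁻¹ := by
    intro X S hX hS
    obtain ⟨W, hW, hWX, hXA⟩ := h2 X S hX hS
    refine ⟨W, hW, by rw [← hU W hW X hX.isSymm_real, hWX], ?_⟩
    have hWW : ((U W)⁻¹ * (U W)⁻¹).IsSymm := by
      rw [Matrix.IsSymm, transpose_mul, (hP W hW).isSymm_real]
    have hSWW : ((U S)⁻¹ * ((U W)⁻¹ * (U W)⁻¹) * (U S)⁻¹).IsSymm := by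
      simp only [Matrix.IsSymm, transpose_mul, (hP W hW).isSymm_real.eq,
        (hP S hS).isSymm_real.eq, Matrix.mul_assoc]
    have h := hXA 1 isSymm_one
    rwa [hU X hX 1 isSymm_one, hU W hW 1 isSymm_one, Matrix.mul_one, Matrix.mul_one,
      hU S hS _ hWW, hU W hW _ hSWW] at h
  obtain ⟨κ, hκ, hκX⟩ := eq_smul_inv_of_scaling (P := fun X => (U X)⁻¹) (hP 1 .one)
    fun G X hG hX => map_mul_mul_self_of_scaling (P := fun X => (U X)⁻¹) hP hNT hG hX
  have hHess' : ∀ X, X.PosDef → ∀ A, A.IsSymm → Hess X A = κ ^ 2 • (X⁻¹ * A * X⁻¹) := by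
    intro X hX A hA
    have := hκX X hX
    rw [hU X hX A hA, this, Matrix.smul_mul, Matrix.mul_smul, Matrix.smul_mul, smul_smul, sq]
  -- The gradient is `C - κ² X⁻¹` for a constant matrix `C`.
  obtain ⟨C, hC⟩ : ∃ C, ∀ X, X.PosDef → grad X = C - κ ^ 2 • X⁻¹ := by
    refine ⟨grad 1 + κ ^ 2 • 1⁻¹, fun X hX => ?_⟩
    rw [eq_sub_iff_add_eq]
    refine eq_of_hasDerivAt_zero_of_posDef (f := fun X => grad X + κ ^ 2 • X⁻¹) ?_ hX
    intro X hX A hA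
    have h := (hHess X hX A hA).add ((hX.hasDerivAt_inv_add_smul A).const_smul (κ ^ 2))
    rw [hHess' X hX A hA, smul_neg, add_neg_cancel] at h
    exact h
  have hCsymm : C.IsSymm := by
    have h1 := hC 1 .one
    rw [inv_one, eq_sub_iff_add_eq] at h1
    rw [← h1]
    exact (hgradsymm 1 .one).add (isSymm_one.smul _)
  -- The Newton decrement bound along the ray through `1` forces `C = 0`.
  obtain rfl : C = 0 := by
    refine hCsymm.eq_zero_of_trace_sq_le (a := κ ^ 2) (b := κ ^ 2 * ν) fun t ht => ?_
    have hpd : (t • (1 : Matrix (Fin n) (Fin n) ℝ)).PosDef := PosDef.one.smul ht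
    have hinv : (t • (1 : Matrix (Fin n) (Fin n) ℝ))⁻¹ = t⁻¹ • 1 :=
      inv_eq_right_inv (by simp [smul_smul, ht.ne'])
    have hsymm := (hgradsymm _ hpd).smul (t ^ 2 / κ ^ 2)
    have h := hν _ hpd _ hsymm (by
      rw [hHess' _ hpd _ hsymm, hinv]
      simp only [Matrix.smul_mul, Matrix.mul_smul, Matrix.one_mul, Matrix.mul_one, smul_smul]
      convert! one_smul ℝ _ using 2
      field_simp)
    have e : t • C - κ ^ 2 • 1 = t • grad (t • 1) := by
      rw [hC _ hpd, hinv, smul_sub, smul_smul, smul_smul]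
      congr 2
      field_simp
    rw [Matrix.mul_smul, trace_smul, smul_eq_mul, div_mul_eq_mul_div,
      div_le_iff₀ (by positivity)] at h
    rw [e, Matrix.mul_smul, Matrix.smul_mul, smul_smul, trace_smul, smul_eq_mul]
    linarith
  refine ⟨κ ^ 2, by positivity, H 1, fun X hX => ?_⟩
  have h := eq_of_hasDerivAt_zero_of_posDef (f := fun X => H X + κ ^ 2 * Real.log X.det) ?_ hX
  · simp only [det_one, Real.log_one, mul_zero, add_zero] at h
    linarith
  · intro X hX A hA
    have h := (hgrad X hX A hA).add ((hX.hasDerivAt_log_det_add_smul A).const_mul (κ ^ 2))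
    convert! h using 1
    simp [hC X hX]
end

section
/- Let T : Sym(n,ℝ) → Sym(n,ℝ) be an invertible linear map that is self-adjoint with respect to the trace inner product, positive definite (i.e., ⟨T A, A⟩ > 0 for every nonzero symmetric A), and maps the open cone Sym⁺(n) onto itself. Then there exists a unique symmetric positive definite matrix W such that T A = W⁻¹ A W⁻¹ for all A ∈ Sym(n,ℝ). Conversely, for every W ∈ Sym⁺(n) the map A ↦ W⁻¹AW⁻¹ is such an automorphism. In other words, the set of self-adjoint positive definite linear automorphisms of Sym(n,ℝ) preserving Sym⁺(n) coincides with {F''(W) : W ∈ Sym⁺(n)}, where F''(W)A = W⁻¹AW⁻¹ is the Hessian of F(X) = -ln det(X). -/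
open Matrix

/-- `T` (a linear map of the full matrix space) restricts to a self-adjoint positive
definite linear automorphism of the space `Sym(n,ℝ)` of symmetric matrices (with the
trace inner product) mapping the open cone `Sym⁺(n)` onto itself. -/
def IsSelfAdjPosDefConeAut (n : ℕ)
    (T : Matrix (Fin n) (Fin n) ℝ →ₗ[ℝ] Matrix (Fin n) (Fin n) ℝ) : Prop :=
  -- `T` maps `Sym(n,ℝ)` to itself,
  (∀ A, A.IsSymm → (T A).IsSymm) ∧
  -- `T` is invertible (bijective) on `Sym(n,ℝ)`,
  (∀ A, A.IsSymm → T A = 0 → A = 0) ∧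
  (∀ B, B.IsSymm → ∃ A, A.IsSymm ∧ T A = B) ∧
  -- `T` is self-adjoint with respect to the trace inner product,
  (∀ A B, A.IsSymm → B.IsSymm → (T A * B).trace = (A * T B).trace) ∧
  -- `T` is positive definite: `⟨T A, A⟩ > 0` for every nonzero symmetric `A`,
  (∀ A, A.IsSymm → A ≠ 0 → 0 < (T A * A).trace) ∧
  -- and `T` maps the open cone `Sym⁺(n)` onto itself.
  (∀ X, X.PosDef → (T X).PosDef) ∧
  (∀ S, S.PosDef → ∃ X, X.PosDef ∧ T X = S)

namespace Matrix

variable {ι : Type*} [Fintype ι]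

/-- A real positive semidefinite matrix satisfies `‖A‖_F ≤ tr A`. -/
theorem PosSemidef.trace_mul_self_le {A : Matrix ι ι ℝ} (hA : A.PosSemidef) :
    (A * A).trace ≤ A.trace ^ 2 := by
  simp only [trace, diag, mul_apply, sq, Finset.sum_mul_sum]
  refine Finset.sum_le_sum fun i _ => Finset.sum_le_sum fun j _ => ?_
  have h := (hA.submatrix ![i, j]).det_nonneg
  rw [det_fin_two] at h
  simpa using h

open scoped MatrixOrder in
theorem PosSemidef.exists_sqrt {A : Matrix ι ι ℝ} [DecidableEq ι] (hA : A.PosSemidef) :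
    ∃ R : Matrix ι ι ℝ, R.IsSymm ∧ R * R = A :=
  ⟨CFC.sqrt A, isHermitian_iff_isSymm.1 (CFC.sqrt_nonneg A).posSemidef.isHermitian,
    CFC.sqrt_mul_sqrt_self A hA.nonneg⟩

open scoped MatrixOrder in
theorem PosSemidef.eq_of_mul_self_eq [DecidableEq ι] {P Q : Matrix ι ι ℝ} (hP : P.PosSemidef)
    (hQ : Q.PosSemidef) (h : P * P = Q * Q) : P = Q :=
  (CFC.sqrt_unique h hP.nonneg).symm.trans (CFC.sqrt_unique rfl hQ.nonneg)

theorem PosSemidef.mul_mul_of_isSymm {A R : Matrix ι ι ℝ} (hA : A.PosSemidef) (hR : R.IsSymm) :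
    (R * A * R).PosSemidef := by
  simpa [hR.eq] using hA.mul_mul_conjTranspose_same R

theorem PosSemidef.trace_mul_nonneg {A B : Matrix ι ι ℝ} (hA : A.PosSemidef)
    (hB : B.PosSemidef) : 0 ≤ (A * B).trace := by
  classical
  obtain ⟨R, hR, rfl⟩ := hA.exists_sqrt
  rw [mul_assoc, trace_mul_comm]
  exact (hB.mul_mul_of_isSymm hR).trace_nonneg

/-- If `P` is positive definite and `tr (P A) = 0` with `A` positive semidefinite, then `A = 0`. -/
theorem PosSemidef.eq_zero_of_trace_mul_eq_zero {A P : Matrix ι ι ℝ} (hA : A.PosSemidef)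
    (hP : P.PosDef) (h : (P * A).trace = 0) : A = 0 := by
  classical
  obtain ⟨R, hR, rfl⟩ := hP.posSemidef.exists_sqrt
  have hu : IsUnit R := isUnit_of_mul_isUnit_left hP.isUnit
  rw [mul_assoc, trace_mul_comm, (hA.mul_mul_of_isSymm hR).trace_eq_zero_iff,
    hu.mul_left_eq_zero, hu.mul_right_eq_zero] at h
  exact h

theorem PosSemidef.trace_mul_mul_mul_le {A P : Matrix ι ι ℝ} (hP : P.PosSemidef)
    (hA : A.PosSemidef) : (P * A * P * A).trace ≤ (P * A).trace ^ 2 := by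
  classical
  obtain ⟨R, hR, rfl⟩ := hP.exists_sqrt
  have h := (hA.mul_mul_of_isSymm hR).trace_mul_self_le
  have h₁ : (R * A * R).trace = (R * R * A).trace := by
    rw [trace_mul_comm, ← mul_assoc]
  have h₂ : (R * A * R * (R * A * R)).trace = (R * R * A * (R * R) * A).trace := by
    rw [← mul_assoc, trace_mul_comm]
    simp only [mul_assoc]
  rwa [h₁, h₂] at h

theorem trace_mul_mul_mul_nonneg {P D : Matrix ι ι ℝ} (hP : P.PosSemidef) (hD : D.IsSymm) :
    0 ≤ (P * D * P * D).trace := by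
  have h := hP.trace_mul_nonneg (hP.mul_mul_of_isSymm hD)
  simpa only [mul_assoc] using h

theorem PosDef.eq_zero_of_trace_mul_mul_mul_nonpos {P D : Matrix ι ι ℝ} (hP : P.PosDef)
    (hD : D.IsSymm) (h : (P * D * P * D).trace ≤ 0) : D = 0 := by
  classical
  have h0 := le_antisymm h (trace_mul_mul_mul_nonneg hP.posSemidef hD)
  have h1 : D * P * D = 0 := (hP.posSemidef.mul_mul_of_isSymm hD).eq_zero_of_trace_mul_eq_zero hP
    (by simpa only [mul_assoc] using h0)
  have h2 : (P * (D * D)).trace = 0 := by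
    rw [trace_mul_comm, mul_assoc, trace_mul_comm, h1, trace_zero]
  have h3 : (D * D).PosSemidef := by
    simpa [hD.eq] using posSemidef_conjTranspose_mul_self D
  have h4 := h3.eq_zero_of_trace_mul_eq_zero hP h2
  refine trace_conjTranspose_mul_self_eq_zero_iff.1 ?_
  simp [hD.eq, h4]

theorem isClosed_setOf_posSemidef : IsClosed {A : Matrix ι ι ℝ | A.PosSemidef} := by
  simp only [posSemidef_iff_dotProduct_mulVec, IsHermitian, Set.ofPred_and, Set.ofPred_forall]
  refine (isClosed_eq (by fun_prop) (by fun_prop)).inter (isClosed_iInter fun x => ?_)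
  exact isClosed_le (by fun_prop) (by fun_prop)

theorem posSemidef_of_forall_add_smul {A B : Matrix ι ι ℝ}
    (h : ∀ ε : ℝ, 0 < ε → (A + ε • B).PosSemidef) : A.PosSemidef := by
  have ht : Filter.Tendsto (fun ε : ℝ => A + ε • B) (nhdsWithin 0 (Set.Ioi 0)) (nhds A) := by
    have : Continuous fun ε : ℝ => A + ε • B := by fun_prop
    simpa using (this.tendsto 0).mono_left nhdsWithin_le_nhds
  exact isClosed_setOf_posSemidef.mem_of_tendsto ht
    (Filter.eventually_of_mem self_mem_nhdsWithin h)

theorem hasDerivAt_log_det_one_add_smul [DecidableEq ι] (M : Matrix ι ι ℝ) :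
    HasDerivAt (fun t : ℝ => Real.log (1 + t • M).det) M.trace 0 := by
  have h : HasDerivAt (fun t : ℝ => (1 + t • M).det) M.trace 0 := by
    rw [funext fun t : ℝ => det_one_add_smul t M]
    set p := (det (1 + (Polynomial.X : Polynomial ℝ) • M.map Polynomial.C)).divX.divX
    have := (((hasDerivAt_id (0 : ℝ)).const_mul M.trace).const_add 1).add
      ((p.hasDerivAt 0).mul ((hasDerivAt_id (0 : ℝ)).pow 2))
    exact this.congr_deriv (by simp)
  simpa using h.log (by simp)

/-- A linear identity on symmetric matrices can be checked on the rank one matrices `v vᵀ`. -/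
theorem IsSymm.eqOn_of_vecMulVec {M : Type*} [AddCommGroup M] [Module ℝ M]
    {f g : Matrix ι ι ℝ →ₗ[ℝ] M}
    (h : ∀ v, f (vecMulVec v v) = g (vecMulVec v v)) {A : Matrix ι ι ℝ} (hA : A.IsSymm) :
    f A = g A := by
  classical
  have hp : ∀ v w, f (vecMulVec v w + vecMulVec w v) = g (vecMulVec v w + vecMulVec w v) := by
    intro v w
    have : vecMulVec v w + vecMulVec w v
        = vecMulVec (v + w) (v + w) - vecMulVec v v - vecMulVec w w := by
      rw [add_vecMulVec, vecMulVec_add, vecMulVec_add]; abel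
    simp only [this, map_sub, h]
  have hs : A = ∑ i, ∑ j, (A i j / 2) •
      (vecMulVec (Pi.single i 1) (Pi.single j 1) + vecMulVec (Pi.single j 1) (Pi.single i 1)) := by
    simp only [smul_add, Finset.sum_add_distrib]
    rw [Finset.sum_comm (f := fun i j => (A i j / 2) • vecMulVec (Pi.single j 1) (Pi.single i 1))]
    simp only [← single_eq_single_vecMulVec_single, hA.apply,
      ← Finset.sum_add_distrib, ← add_smul, add_halves]
    conv_lhs => rw [matrix_eq_sum_single A]
    simp
  rw [hs]
  simp only [map_sum, map_smul, hp]

end Matrix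

namespace IsSelfAdjPosDefConeAut

variable {n : ℕ} {T : Matrix (Fin n) (Fin n) ℝ →ₗ[ℝ] Matrix (Fin n) (Fin n) ℝ}

theorem map_posSemidef (h : IsSelfAdjPosDefConeAut n T) {A : Matrix (Fin n) (Fin n) ℝ}
    (hA : A.PosSemidef) : (T A).PosSemidef := by
  obtain ⟨-, -, -, -, -, hpd, -⟩ := h
  refine posSemidef_of_forall_add_smul (B := T 1) fun ε hε => ?_
  rw [← map_smul, ← map_add]
  exact (hpd _ (PosDef.posSemidef_add hA (PosDef.one.smul hε))).posSemidef

theorem exists_posSemidef_map_eq (h : IsSelfAdjPosDefConeAut n T)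
    {S : Matrix (Fin n) (Fin n) ℝ} (hS : S.PosSemidef) : ∃ Y, Y.PosSemidef ∧ T Y = S := by
  obtain ⟨-, hinj, hsurj, -, -, -, hpd⟩ := h
  obtain ⟨Y, hY, rfl⟩ := hsurj S (isHermitian_iff_isSymm.1 hS.isHermitian)
  obtain ⟨K, hK, hTK⟩ := hpd 1 PosDef.one
  refine ⟨Y, posSemidef_of_forall_add_smul (B := K) fun ε hε => ?_, rfl⟩
  obtain ⟨X, hX, hTX⟩ := hpd (T Y + ε • 1) (PosDef.posSemidef_add hS (PosDef.one.smul hε))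
  have hs : (Y + ε • K - X).IsSymm :=
    (hY.add ((isHermitian_iff_isSymm.1 hK.isHermitian).smul ε)).sub
      (isHermitian_iff_isSymm.1 hX.isHermitian)
  have := hinj _ hs (by rw [map_sub, map_add, map_smul, hTK, hTX, sub_self])
  rw [sub_eq_zero.1 this]
  exact hX.posSemidef

theorem continuous_trace_map_mul_self
    (T : Matrix (Fin n) (Fin n) ℝ →ₗ[ℝ] Matrix (Fin n) (Fin n) ℝ) :
    Continuous fun A => (T A * A).trace := by
  have := T.continuous_of_finiteDimensional
  fun_prop

section Compactness

attribute [local instance] Matrix.normedAddCommGroup Matrix.normedSpace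

theorem isCompact_setOf_trace_le (h : IsSelfAdjPosDefConeAut n T) (c : ℝ) :
    IsCompact {X : Matrix (Fin n) (Fin n) ℝ | X.PosSemidef ∧ (T X * X).trace ≤ c} := by
  obtain ⟨-, -, -, -, hpos, -, -⟩ := h
  have hq := continuous_trace_map_mul_self T
  have hsymm : IsClosed {A : Matrix (Fin n) (Fin n) ℝ | A.IsSymm} :=
    isClosed_eq (by fun_prop) (by fun_prop)
  obtain ⟨μ, hμ, hle⟩ := ((isCompact_sphere (0 : Matrix (Fin n) (Fin n) ℝ) 1).inter_right
    hsymm).exists_forall_le' hq.continuousOn (a := 0) fun A hA =>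
      hpos A hA.2 (norm_ne_zero_iff.1 (by simp [mem_sphere_zero_iff_norm.1 hA.1]))
  refine Metric.isCompact_of_isClosed_isBounded
    (isClosed_setOf_posSemidef.inter (isClosed_le hq continuous_const)) ?_
  refine (isBounded_iff_forall_norm_le).2 ⟨√(c / μ), fun X hX => Real.le_sqrt_of_sq_le ?_⟩
  rw [le_div_iff₀ hμ]
  refine le_trans ?_ hX.2
  rcases eq_or_ne X 0 with rfl | h0
  · simp
  have hn : 0 < ‖X‖ := norm_pos_iff.2 h0
  have := hle (‖X‖⁻¹ • X) ⟨by simp [norm_smul, hn.ne'],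
    (isHermitian_iff_isSymm.1 hX.1.isHermitian).smul _⟩
  simp only [map_smul, smul_mul, Matrix.mul_smul, trace_smul, smul_eq_mul] at this
  field_simp at this
  linarith

end Compactness

/-- The function `Z ↦ log det Z - ⟨T Z, Z⟩ / 2` attains its maximum over the positive definite
cone, in a slightly strengthened form. -/
theorem exists_max_log_det (h : IsSelfAdjPosDefConeAut n T) (hn : n ≠ 0) :
    ∃ W : Matrix (Fin n) (Fin n) ℝ, W.PosDef ∧ (T W * W).trace ≤ n ∧
      ∀ Z : Matrix (Fin n) (Fin n) ℝ, Z.PosDef →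
        Real.log Z.det - (T Z * Z).trace / 2 + n / 2 ≤ Real.log W.det := by
  have hcomp := h.isCompact_setOf_trace_le n
  obtain ⟨-, -, -, -, hpos, -, -⟩ := h
  have : NeZero n := ⟨hn⟩
  have hn' : (0 : ℝ) < n := by positivity
  obtain ⟨W, ⟨hWp, hWq⟩, hmax⟩ := hcomp.exists_isMaxOn
    ⟨0, PosSemidef.zero, by simp⟩ (continuous_id.matrix_det).continuousOn
  have key : ∀ Z : Matrix (Fin n) (Fin n) ℝ, Z.PosDef → 0 < (T Z * Z).trace ∧
      √(n / (T Z * Z).trace) ^ n * Z.det ≤ W.det := by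
    intro Z hZ
    have hZ0 : Z ≠ 0 := by
      rintro rfl
      simpa using hZ.det_pos
    have hq := hpos Z (isHermitian_iff_isSymm.1 hZ.isHermitian) hZ0
    refine ⟨hq, ?_⟩
    have := hmax (a := √(n / (T Z * Z).trace) • Z)
      ⟨hZ.posSemidef.smul (Real.sqrt_nonneg _), by
        simp only [map_smul, smul_mul, Matrix.mul_smul, trace_smul, smul_eq_mul]
        rw [← mul_assoc, Real.mul_self_sqrt (by positivity), div_mul_cancel₀ _ hq.ne']⟩
    simpa [det_smul] using this
  have hWdet : 0 < W.det := by
    obtain ⟨hq, hle⟩ := key 1 PosDef.one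
    refine lt_of_lt_of_le ?_ hle
    rw [det_one]
    positivity
  refine ⟨W, hWp.posDef_iff_det_ne_zero.2 hWdet.ne', hWq, fun Z hZ => ?_⟩
  obtain ⟨hq, hle⟩ := key Z hZ
  have hZd := hZ.det_pos
  have hlog := Real.log_le_log (by positivity) hle
  rw [Real.log_mul (by positivity) hZd.ne', Real.log_pow, Real.log_sqrt (by positivity)] at hlog
  have h1 := Real.one_sub_inv_le_log_of_pos (div_pos hn' hq)
  have h2 := mul_le_mul_of_nonneg_left h1 hn'.le
  rw [inv_div, mul_sub, mul_one, mul_div_cancel₀ _ hn'.ne'] at h2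
  linarith

/-- The dual scaling equation `T W = W⁻¹` has a positive definite solution. -/
theorem exists_map_eq_inv (h : IsSelfAdjPosDefConeAut n T) :
    ∃ W : Matrix (Fin n) (Fin n) ℝ, W.PosDef ∧ T W = W⁻¹ := by
  rcases eq_or_ne n 0 with rfl | hn
  · exact ⟨1, PosDef.one, Subsingleton.elim _ _⟩
  obtain ⟨W, hW, hWq, hmax⟩ := h.exists_max_log_det hn
  obtain ⟨hsymm, -, -, hself, -, -, -⟩ := h
  have hWs := isHermitian_iff_isSymm.1 hW.isHermitian
  have hWu : IsUnit W.det := (isUnit_iff_isUnit_det _).1 hW.isUnit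
  have key : ∀ D : Matrix (Fin n) (Fin n) ℝ, D.IsSymm →
      (∀ t : ℝ, 0 < t → t < 1 → (W + t • D).PosDef) → (W⁻¹ * D).trace ≤ (T W * D).trace := by
    intro D hD hpd
    have hderiv : HasDerivAt (fun t : ℝ => Real.log (1 + t • (W⁻¹ * D)).det
        - t * (T W * D).trace - t ^ 2 * ((T D * D).trace / 2))
        ((W⁻¹ * D).trace - (T W * D).trace) 0 := by
      have := ((hasDerivAt_log_det_one_add_smul (W⁻¹ * D)).sub
        ((hasDerivAt_id (0 : ℝ)).mul_const (T W * D).trace)).sub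
        (((hasDerivAt_id (0 : ℝ)).pow 2).mul_const ((T D * D).trace / 2))
      exact this.congr_deriv (by simp)
    rw [← sub_nonpos]
    refine le_of_tendsto hderiv.tendsto_slope_zero_right ?_
    filter_upwards [Ioo_mem_nhdsGT (zero_lt_one' ℝ)] with t ht
    have hp := hpd t ht.1 ht.2
    have hm := hmax _ hp
    have hdet : (W + t • D).det = W.det * (1 + t • (W⁻¹ * D)).det := by
      rw [← det_mul, mul_add, mul_one, Matrix.mul_smul, mul_nonsing_inv_cancel_left _ _ hWu]
    have hd := hp.det_pos
    rw [hdet] at hd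
    have hd' := pos_of_mul_pos_right hd hW.det_pos.le
    rw [hdet, Real.log_mul hW.det_pos.ne' hd'.ne'] at hm
    have hcross : (T D * W).trace = (T W * D).trace := by
      rw [hself D W hD hWs, trace_mul_comm]
    have hq : (T (W + t • D) * (W + t • D)).trace = (T W * W).trace
        + 2 * t * (T W * D).trace + t ^ 2 * (T D * D).trace := by
      simp only [map_add, map_smul, add_mul, mul_add, smul_mul, Matrix.mul_smul, trace_add,
        trace_smul, smul_eq_mul, hcross]
      ring
    rw [hq] at hm
    refine mul_nonpos_of_nonneg_of_nonpos (inv_nonneg.2 ht.1.le) ?_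
    simp only [zero_add, zero_smul, add_zero, det_one, Real.log_one]
    nlinarith
  have hGs : (T W - W⁻¹).IsSymm :=
    (hsymm W hWs).sub (isHermitian_iff_isSymm.1 hW.inv.isHermitian)
  have hG : (T W - W⁻¹).PosSemidef := by
    refine PosSemidef.of_dotProduct_mulVec_nonneg (isHermitian_iff_isSymm.2 hGs) fun v => ?_
    have := key (vecMulVec v v) (transpose_vecMulVec v v) fun t ht _ =>
      hW.add_posSemidef (PosSemidef.smul (by simpa using posSemidef_vecMulVec_self_star v) ht.le)
    simp only [mul_vecMulVec, trace_vecMulVec] at this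
    rw [sub_mulVec, dotProduct_sub]
    simpa [dotProduct_comm] using this
  have hle : (W⁻¹ * -W).trace ≤ (T W * -W).trace := by
    refine key (-W) hWs.neg fun t _ ht => ?_
    have : W + t • -W = (1 - t) • W := by module
    rw [this]
    exact hW.smul (sub_pos.2 ht)
  refine ⟨W, hW, sub_eq_zero.1 (hG.eq_zero_of_trace_mul_eq_zero hW (le_antisymm ?_ ?_))⟩
  · rw [trace_mul_comm, sub_mul, trace_sub]
    simp only [mul_neg, trace_neg] at hle
    linarith
  · exact hW.posSemidef.trace_mul_nonneg hG

/-- If `T W = W⁻¹`, then `A ↦ W (T A) W` squares to the identity on rank one matrices. -/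
theorem map_mul_map_mul_vecMulVec (h : IsSelfAdjPosDefConeAut n T)
    {W : Matrix (Fin n) (Fin n) ℝ} (hW : W.PosDef) (hTW : T W = W⁻¹) (v : Fin n → ℝ) :
    T (W * T (vecMulVec v v) * W) = W⁻¹ * vecMulVec v v * W⁻¹ := by
  set A := vecMulVec v v with hA_def
  have hWs := isHermitian_iff_isSymm.1 hW.isHermitian
  have hWis := isHermitian_iff_isSymm.1 hW.inv.isHermitian
  have hWu : IsUnit W.det := (isUnit_iff_isUnit_det _).1 hW.isUnit
  have hA : A.PosSemidef := by simpa using posSemidef_vecMulVec_self_star v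
  have hTA := h.map_posSemidef hA
  obtain ⟨Y, hY, hTY⟩ := h.exists_posSemidef_map_eq (hA.mul_mul_of_isSymm hWis)
  obtain ⟨hsymm, -, -, hself, -, -, -⟩ := h
  have hAs := isHermitian_iff_isSymm.1 hA.isHermitian
  have hYs := isHermitian_iff_isSymm.1 hY.isHermitian
  have hX : (W * T A * W).PosSemidef := hTA.mul_mul_of_isSymm hWs
  have hXs := isHermitian_iff_isSymm.1 hX.isHermitian
  have hWX : W⁻¹ * (W * T A * W) = T A * W := by
    rw [mul_assoc, nonsing_inv_mul_cancel_left _ _ hWu]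
  have hXt : (W⁻¹ * (W * T A * W)).trace = (W⁻¹ * A).trace := by
    rw [hWX, hself A W hAs hWs, hTW, trace_mul_comm]
  have hYt : (W⁻¹ * Y).trace = (W⁻¹ * A).trace := by
    rw [← hTW, hself W Y hWs hYs, hTY, hTW, mul_assoc, mul_nonsing_inv_cancel_left _ _ hWu,
      trace_mul_comm]
  have hX2 := hW.inv.posSemidef.trace_mul_mul_mul_le hX
  have hY2 := hW.inv.posSemidef.trace_mul_mul_mul_le hY
  have hXY : (W⁻¹ * (W * T A * W) * W⁻¹ * Y).trace = (W⁻¹ * A).trace ^ 2 := by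
    rw [hWX, mul_nonsing_inv_cancel_right _ _ hWu, hself A Y hAs hYs, hTY, hA_def]
    simp only [mul_vecMulVec, vecMulVec_mul, trace_vecMulVec, vecMulVec_mulVec, op_smul_eq_smul,
      smul_dotProduct, smul_eq_mul]
    rw [dotProduct_comm v (v ᵥ* W⁻¹), ← dotProduct_mulVec, dotProduct_comm v, sq]
  have hYX : (W⁻¹ * Y * W⁻¹ * (W * T A * W)).trace = (W⁻¹ * A).trace ^ 2 := by
    rw [← hXY, mul_assoc (W⁻¹ * Y), trace_mul_comm, ← mul_assoc]
  have hD := hW.inv.eq_zero_of_trace_mul_mul_mul_nonpos (hXs.sub hYs) (by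
    simp only [mul_sub, sub_mul, trace_sub]
    rw [hXt] at hX2
    rw [hYt] at hY2
    linarith)
  rw [sub_eq_zero.1 hD, hTY]

theorem map_eq_of_map_eq_inv (h : IsSelfAdjPosDefConeAut n T)
    {W : Matrix (Fin n) (Fin n) ℝ} (hW : W.PosDef) (hTW : T W = W⁻¹)
    {A : Matrix (Fin n) (Fin n) ℝ} (hA : A.IsSymm) : T A = W⁻¹ * A * W⁻¹ := by
  have hWs := isHermitian_iff_isSymm.1 hW.isHermitian
  have hWis := isHermitian_iff_isSymm.1 hW.inv.isHermitian
  have hWu : IsUnit W.det := (isUnit_iff_isUnit_det _).1 hW.isUnit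
  have hsq : T (W * T A * W) = W⁻¹ * A * W⁻¹ :=
    hA.eqOn_of_vecMulVec
      (f := T ∘ₗ LinearMap.mulRight ℝ W ∘ₗ LinearMap.mulLeft ℝ W ∘ₗ T)
      (g := LinearMap.mulRight ℝ W⁻¹ ∘ₗ LinearMap.mulLeft ℝ W⁻¹)
      fun v => h.map_mul_map_mul_vecMulVec hW hTW v
  obtain ⟨hsymm, -, -, -, hpos, -, -⟩ := h
  have hBs : (T A - W⁻¹ * A * W⁻¹).IsSymm := by
    refine (hsymm A hA).sub ?_
    simp [IsSymm, transpose_mul, hA.eq, hWis.eq, mul_assoc]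
  have hDs : (W * (T A - W⁻¹ * A * W⁻¹) * W).IsSymm := by
    rw [IsSymm, transpose_mul, transpose_mul, hBs.eq, hWs.eq, mul_assoc W]
  have hD : W * (T A - W⁻¹ * A * W⁻¹) * W = W * T A * W - A := by
    simp [mul_sub, sub_mul, mul_assoc, mul_nonsing_inv_cancel_left _ _ hWu,
      nonsing_inv_mul _ hWu]
  have hTD : T (W * (T A - W⁻¹ * A * W⁻¹) * W) = -(T A - W⁻¹ * A * W⁻¹) := by
    rw [hD, map_sub, hsq, neg_sub]
  by_contra hne
  have hD0 : W * (T A - W⁻¹ * A * W⁻¹) * W ≠ 0 := by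
    rw [Ne, hW.isUnit.mul_left_eq_zero, hW.isUnit.mul_right_eq_zero, sub_eq_zero]
    exact hne
  have h1 := hpos _ hDs hD0
  have h2 := trace_mul_mul_mul_nonneg hW.posSemidef hBs
  rw [hTD, neg_mul, trace_neg, trace_mul_comm] at h1
  linarith

theorem of_posDef {W : Matrix (Fin n) (Fin n) ℝ} (hW : W.PosDef) :
    IsSelfAdjPosDefConeAut n (LinearMap.mulRight ℝ W⁻¹ ∘ₗ LinearMap.mulLeft ℝ W⁻¹) := by
  have hWs := isHermitian_iff_isSymm.1 hW.isHermitian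
  have hWis := isHermitian_iff_isSymm.1 hW.inv.isHermitian
  have hWu : IsUnit W.det := (isUnit_iff_isUnit_det _).1 hW.isUnit
  have hconj : ∀ {P A : Matrix (Fin n) (Fin n) ℝ}, P.IsSymm → A.IsSymm → (P * A * P).IsSymm :=
    fun hP hA => by simp only [IsSymm, transpose_mul, hP.eq, hA.eq, mul_assoc]
  have hpd : ∀ {P A : Matrix (Fin n) (Fin n) ℝ}, P.PosDef → A.PosDef → (P * A * P).PosDef :=
    fun {P A} hP hA => by
      have := (IsUnit.posDef_star_right_conjugate_iff hP.isUnit).2 hA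
      rwa [star_eq_conjTranspose, hP.isHermitian.eq] at this
  have hcancel : ∀ B : Matrix (Fin n) (Fin n) ℝ, W⁻¹ * (W * B * W) * W⁻¹ = B := fun B => by
    rw [mul_assoc W, nonsing_inv_mul_cancel_left _ _ hWu, mul_nonsing_inv_cancel_right _ _ hWu]
  simp only [IsSelfAdjPosDefConeAut, LinearMap.comp_apply, LinearMap.mulLeft_apply,
    LinearMap.mulRight_apply]
  refine ⟨fun A hA => hconj hWis hA, fun A _ h0 => ?_,
    fun B hB => ⟨W * B * W, hconj hWs hB, hcancel B⟩, fun A B _ _ => ?_, fun A hA hA0 => ?_,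
    fun X hX => hpd hW.inv hX, fun S hS => ⟨W * S * W, hpd hW hS, hcancel S⟩⟩
  · rwa [hW.inv.isUnit.mul_left_eq_zero, hW.inv.isUnit.mul_right_eq_zero] at h0
  · rw [mul_assoc, mul_assoc, trace_mul_comm]
    simp only [mul_assoc]
  · by_contra! hle
    exact hA0 (hW.inv.eq_zero_of_trace_mul_mul_mul_nonpos hA hle)

end IsSelfAdjPosDefConeAut

/-- The self-adjoint positive definite linear automorphisms of `Sym(n,ℝ)` preserving
the cone `Sym⁺(n)` are exactly the maps `A ↦ W⁻¹ A W⁻¹` with `W ∈ Sym⁺(n)` — the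
Hessians `F''(W)` of the standard logarithmic barrier `F(X) = -ln det X` —, the
matrix `W` being uniquely determined. -/
theorem statement10 (n : ℕ) :
    (∀ T : Matrix (Fin n) (Fin n) ℝ →ₗ[ℝ] Matrix (Fin n) (Fin n) ℝ,
      IsSelfAdjPosDefConeAut n T →
        ∃! W : Matrix (Fin n) (Fin n) ℝ, W.PosDef ∧
          ∀ A, A.IsSymm → T A = W⁻¹ * A * W⁻¹) ∧
    (∀ W : Matrix (Fin n) (Fin n) ℝ, W.PosDef →
      ∃ T : Matrix (Fin n) (Fin n) ℝ →ₗ[ℝ] Matrix (Fin n) (Fin n) ℝ,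
        IsSelfAdjPosDefConeAut n T ∧ ∀ A, T A = W⁻¹ * A * W⁻¹) := by
  refine ⟨fun T h => ?_, fun W hW => ⟨_, IsSelfAdjPosDefConeAut.of_posDef hW, fun A => rfl⟩⟩
  obtain ⟨W, hW, hTW⟩ := h.exists_map_eq_inv
  refine ⟨W, ⟨hW, fun A hA => h.map_eq_of_map_eq_inv hW hTW hA⟩, fun V ⟨hV, hVT⟩ => ?_⟩
  have hsq : V⁻¹ * V⁻¹ = W⁻¹ * W⁻¹ := by
    have h₁ := hVT 1 isSymm_one
    have h₂ := h.map_eq_of_map_eq_inv hW hTW isSymm_one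
    rw [mul_one] at h₁ h₂
    rw [← h₁, h₂]
  have hinv := hV.inv.posSemidef.eq_of_mul_self_eq hW.inv.posSemidef hsq
  rw [← nonsing_inv_nonsing_inv V ((isUnit_iff_isUnit_det _).1 hV.isUnit), hinv,
    nonsing_inv_nonsing_inv W ((isUnit_iff_isUnit_det _).1 hW.isUnit)]
end
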